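/- (GYP theorem — classical KL case used as template) Let P and R be probability measures on (X, 𝔐) with P ≪ R. Then the Kullback–Leibler relative entropy I(P‖R) = ∫_X ln(dP/dR) dP equals the supremum over all finite measurable partitions {E_k}_{k=1}^m of X of Σ_{k=1}^m P(E_k) ln(P(E_k)/R(E_k)). -/

import Mathlib

open MeasureTheory ENNReal Filter

/-- A finite measurable partition of `X`. -/
structure FinPartition (X : Type*) [MeasurableSpace X] where
  m : ℕ
  E : Fin m → Set X
  meas : ∀ k, MeasurableSet (E k)
  disj : Pairwise (Function.onFun Disjoint E)
  cover : ⋃ k, E k = Set.univ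

open InformationTheory

namespace FinPartition

variable {X : Type*} [MeasurableSpace X]

/-- The partition of `X` into the fibres of a measurable map to `Fin m`. -/
def ofMeasurable {m : ℕ} (g : X → Fin m) (hg : Measurable g) : FinPartition X where
  m := m
  E k := g ⁻¹' {k}
  meas k := hg (measurableSet_singleton k)
  disj i j hij := Disjoint.preimage g (by simpa using hij)
  cover := by ext x; simp

lemma sum_measureReal (π : FinPartition X) (P : Measure X) [IsProbabilityMeasure P] :
    ∑ k, P.real (π.E k) = 1 := by
  rw [← measureReal_iUnion_fintype π.disj π.meas, π.cover, probReal_univ]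

/-- The relative entropy of `P` with respect to `R` along `π`, as a sum of nonnegative terms. -/
lemma sum_mul_log_eq_sum_klFun (π : FinPartition X) {P R : Measure X}
    [IsProbabilityMeasure P] [IsProbabilityMeasure R] (h : P ≪ R) :
    ∑ k, (P (π.E k)).toReal * Real.log ((P (π.E k)).toReal / (R (π.E k)).toReal)
      = ∑ k, R.real (π.E k) * klFun (P.real (π.E k) / R.real (π.E k)) := by
  have key : ∀ k, R.real (π.E k) * klFun (P.real (π.E k) / R.real (π.E k)) =
      P.real (π.E k) * Real.log (P.real (π.E k) / R.real (π.E k))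
        + (R.real (π.E k) - P.real (π.E k)) := by
    intro k
    by_cases hk : R (π.E k) = 0
    · simp [measureReal_def, hk, h hk]
    · have hk' : R.real (π.E k) ≠ 0 := by
        simpa [measureReal_def, ENNReal.toReal_eq_zero_iff] using hk
      rw [klFun]
      field_simp
      ring
  rw [Finset.sum_congr rfl fun k _ ↦ key k, Finset.sum_add_distrib, Finset.sum_sub_distrib,
    π.sum_measureReal, π.sum_measureReal]
  simp [measureReal_def]

lemma sum_klFun_nonneg (π : FinPartition X) (P R : Measure X) :
    0 ≤ ∑ k, R.real (π.E k) * klFun (P.real (π.E k) / R.real (π.E k)) :=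
  Finset.sum_nonneg fun _ _ ↦ mul_nonneg measureReal_nonneg (klFun_nonneg (by positivity))

lemma sum_klFun_le_integral (π : FinPartition X) {P R : Measure X}
    [IsProbabilityMeasure P] [IsProbabilityMeasure R] (h : P ≪ R)
    (hint : Integrable (fun x ↦ klFun (P.rnDeriv R x).toReal) R) :
    ∑ k, R.real (π.E k) * klFun (P.real (π.E k) / R.real (π.E k))
      ≤ ∫ x, klFun (P.rnDeriv R x).toReal ∂ R := by
  rw [← setIntegral_univ, ← π.cover,
    integral_iUnion_fintype π.meas π.disj fun _ ↦ hint.integrableOn]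
  refine Finset.sum_le_sum fun k _ ↦ ?_
  by_cases hk : R (π.E k) = 0
  · simp [measureReal_def, hk, Measure.restrict_eq_zero.mpr hk]
  have hk' : 0 < R.real (π.E k) := by
    simpa [measureReal_def, ENNReal.toReal_pos_iff, pos_iff_ne_zero] using hk
  have jensen := convexOn_klFun.map_set_average_le continuous_klFun.continuousOn isClosed_Ici
    hk (measure_ne_top R _) (ae_of_all _ fun x ↦ ENNReal.toReal_nonneg (a := P.rnDeriv R x))
    Measure.integrable_toReal_rnDeriv.integrableOn hint.integrableOn
  rw [setAverage_eq, setAverage_eq, Measure.setIntegral_toReal_rnDeriv h, smul_eq_mul, smul_eq_mul,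
    inv_mul_eq_div, inv_mul_eq_div, le_div_iff₀ hk'] at jensen
  rwa [mul_comm]

lemma ofReal_sum_klFun_le_klDiv (π : FinPartition X) {P R : Measure X}
    [IsProbabilityMeasure P] [IsProbabilityMeasure R] (h : P ≪ R) :
    ENNReal.ofReal (∑ k, R.real (π.E k) * klFun (P.real (π.E k) / R.real (π.E k)))
      ≤ klDiv P R := by
  by_cases hint : Integrable (llr P R) P
  · rw [klDiv_eq_integral_klFun, if_pos ⟨h, hint⟩]
    exact ENNReal.ofReal_le_ofReal
      (π.sum_klFun_le_integral h ((integrable_klFun_rnDeriv_iff h).mpr hint))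
  · simp [klDiv_of_not_integrable hint]

lemma lintegral_klFun_ofMeasurable {m : ℕ} (g : X → Fin m) (hg : Measurable g)
    (P R : Measure X) [IsFiniteMeasure R] :
    ∫⁻ x, ENNReal.ofReal (klFun (P.real (g ⁻¹' {g x}) / R.real (g ⁻¹' {g x}))) ∂ R
      = ENNReal.ofReal (∑ k, R.real ((ofMeasurable g hg).E k) *
          klFun (P.real ((ofMeasurable g hg).E k) / R.real ((ofMeasurable g hg).E k))) := by
  have hnn : ∀ k, 0 ≤ klFun (P.real (g ⁻¹' {k}) / R.real (g ⁻¹' {k})) :=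
    fun k ↦ klFun_nonneg (by positivity)
  change _ = ENNReal.ofReal (∑ k : Fin m, R.real (g ⁻¹' {k}) *
    klFun (P.real (g ⁻¹' {k}) / R.real (g ⁻¹' {k})))
  rw [← lintegral_map (f := fun k ↦
      ENNReal.ofReal (klFun (P.real (g ⁻¹' {k}) / R.real (g ⁻¹' {k}))))
      (measurable_of_finite _) hg, lintegral_fintype,
    ENNReal.ofReal_sum_of_nonneg fun k _ ↦ mul_nonneg measureReal_nonneg (hnn k)]
  refine Finset.sum_congr rfl fun k _ ↦ ?_
  rw [Measure.map_apply hg (measurableSet_singleton k), ENNReal.ofReal_mul measureReal_nonneg,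
    ofReal_measureReal, mul_comm]

end FinPartition

section Approximation

variable {X : Type*} [MeasurableSpace X]

/-- The ratio `P s / R s` lies between any bounds of the density of `P` on `s`. -/
lemma measureReal_div_mem_Icc_of_rnDeriv {P R : Measure X} [IsFiniteMeasure P] [IsFiniteMeasure R]
    (h : P ≪ R) {s : Set X} (hs : MeasurableSet s) (hRs : R s ≠ 0) {a b : ℝ}
    (hab : ∀ x ∈ s, (P.rnDeriv R x).toReal ∈ Set.Icc a b) :
    P.real s / R.real s ∈ Set.Icc a b := by
  have hpos : 0 < R.real s := by
    simpa [measureReal_def, ENNReal.toReal_pos_iff, pos_iff_ne_zero] using hRs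
  have hf : IntegrableOn (fun x ↦ (P.rnDeriv R x).toReal) s R :=
    Measure.integrable_toReal_rnDeriv.integrableOn
  have hc : ∀ c : ℝ, IntegrableOn (fun _ ↦ c) s R := fun c ↦ integrable_const c
  have h1 := setIntegral_mono_on (hc a) hf hs fun x hx ↦ (hab x hx).1
  have h2 := setIntegral_mono_on hf (hc b) hs fun x hx ↦ (hab x hx).2
  rw [Measure.setIntegral_toReal_rnDeriv h, setIntegral_const, smul_eq_mul] at h1 h2
  exact ⟨(le_div_iff₀ hpos).mpr (by linarith), (div_le_iff₀ hpos).mpr (by linarith)⟩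

lemma ae_measure_preimage_singleton_ne_zero {ι : Type*} [Countable ι] (R : Measure X)
    (g : X → ι) : ∀ᵐ x ∂ R, R (g ⁻¹' {g x}) ≠ 0 := by
  have hk : ∀ k : ι, ∀ᵐ x ∂ R, g x = k → R (g ⁻¹' {k}) ≠ 0 := by
    intro k
    by_cases h0 : R (g ⁻¹' {k}) = 0
    · filter_upwards [measure_eq_zero_iff_ae_notMem.mp h0] with x hx hxk
      exact absurd hxk hx
    · exact ae_of_all _ fun _ _ ↦ h0
  filter_upwards [ae_all_iff.mpr hk] with x hx using hx _ rfl

/-- Discretization of a nonnegative real at scale `1 / (n + 1)`, truncated at `n + 1`. -/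
noncomputable def truncFloor (n : ℕ) (t : ℝ) : Fin ((n + 1) * (n + 1) + 1) :=
  ⟨min ⌊(n + 1) * t⌋₊ ((n + 1) * (n + 1)), Nat.lt_succ_of_le (min_le_right _ _)⟩

lemma measurable_truncFloor (n : ℕ) : Measurable (truncFloor n) := by
  have hk : Measurable fun k : ℕ ↦ (⟨min k ((n + 1) * (n + 1)),
      Nat.lt_succ_of_le (min_le_right _ _)⟩ : Fin ((n + 1) * (n + 1) + 1)) := measurable_from_nat
  exact hk.comp (Nat.measurable_floor.comp (measurable_const.mul measurable_id))

lemma mem_Icc_of_truncFloor_eq {n : ℕ} {s t : ℝ} (hs : 0 ≤ s) (ht : 0 ≤ t) (htn : t < n + 1)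
    (hst : truncFloor n s = truncFloor n t) :
    s ∈ Set.Icc (t - 1 / (n + 1)) (t + 1 / (n + 1)) := by
  have hn : (0 : ℝ) < n + 1 := by positivity
  have hlt : ⌊(n + 1) * t⌋₊ < (n + 1) * (n + 1) := by
    rw [Nat.floor_lt (by positivity)]
    push_cast
    exact mul_lt_mul_of_pos_left htn hn
  have hfl : ⌊(n + 1) * s⌋₊ = ⌊(n + 1) * t⌋₊ := by
    have := congrArg Fin.val hst
    simp only [truncFloor] at this
    omega
  have s1 := Nat.floor_le (mul_nonneg hn.le hs)
  have s2 := Nat.lt_floor_add_one ((n + 1) * s)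
  have t1 := Nat.floor_le (mul_nonneg hn.le ht)
  have t2 := Nat.lt_floor_add_one ((n + 1) * t)
  rw [hfl] at s1 s2
  have e : (n + 1 : ℝ) * (1 / (n + 1)) = 1 := by field_simp
  constructor
  · refine le_of_mul_le_mul_left ?_ hn
    rw [mul_sub, e]
    linarith
  · refine le_of_mul_le_mul_left ?_ hn
    rw [mul_add, e]
    linarith

/-- The average densities on level sets of the discretized density converge to the density. -/
lemma ae_tendsto_measureReal_div_truncFloor {P R : Measure X} [IsFiniteMeasure P]
    [IsFiniteMeasure R] (h : P ≪ R) {g : (n : ℕ) → X → Fin ((n + 1) * (n + 1) + 1)}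
    (hg : ∀ n x, g n x = truncFloor n (P.rnDeriv R x).toReal) (hgm : ∀ n, Measurable (g n)) :
    ∀ᵐ x ∂ R, Tendsto (fun n ↦ P.real (g n ⁻¹' {g n x}) / R.real (g n ⁻¹' {g n x})) atTop
      (nhds (P.rnDeriv R x).toReal) := by
  filter_upwards [ae_all_iff.mpr fun n ↦ ae_measure_preimage_singleton_ne_zero R (g n)] with x hx
  have hb : ∀ᶠ n : ℕ in atTop, P.real (g n ⁻¹' {g n x}) / R.real (g n ⁻¹' {g n x}) ∈
      Set.Icc ((P.rnDeriv R x).toReal - 1 / (n + 1)) ((P.rnDeriv R x).toReal + 1 / (n + 1)) := by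
    obtain ⟨N, hN⟩ := exists_nat_gt (P.rnDeriv R x).toReal
    filter_upwards [eventually_ge_atTop N] with n hn
    refine measureReal_div_mem_Icc_of_rnDeriv h (hgm n (measurableSet_singleton _)) (hx n) ?_
    intro y hy
    have hNn : (N : ℝ) ≤ n := by exact_mod_cast hn
    refine mem_Icc_of_truncFloor_eq ENNReal.toReal_nonneg ENNReal.toReal_nonneg (by linarith) ?_
    rw [← hg, ← hg]
    exact hy
  have h0 := tendsto_one_div_add_atTop_nhds_zero_nat (𝕜 := ℝ)
  refine tendsto_of_tendsto_of_tendsto_of_le_of_le' ?_ ?_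
    (hb.mono fun _ hn ↦ hn.1) (hb.mono fun _ hn ↦ hn.2)
  · simpa using h0.const_sub (P.rnDeriv R x).toReal
  · simpa using h0.const_add (P.rnDeriv R x).toReal

lemma klDiv_le_of_forall_finPartition {P R : Measure X} [IsProbabilityMeasure P]
    [IsProbabilityMeasure R] (h : P ≪ R) {t : ℝ≥0∞}
    (ht : ∀ π : FinPartition X, ENNReal.ofReal
      (∑ k, R.real (π.E k) * klFun (P.real (π.E k) / R.real (π.E k))) ≤ t) :
    klDiv P R ≤ t := by
  let g : (n : ℕ) → X → Fin ((n + 1) * (n + 1) + 1) :=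
    fun n x ↦ truncFloor n (P.rnDeriv R x).toReal
  have hgm : ∀ n, Measurable (g n) := fun n ↦
    (measurable_truncFloor n).comp (Measure.measurable_rnDeriv P R).ennreal_toReal
  let F : ℕ → X → ℝ≥0∞ := fun n x ↦
    ENNReal.ofReal (klFun (P.real (g n ⁻¹' {g n x}) / R.real (g n ⁻¹' {g n x})))
  have hFm : ∀ n, Measurable (F n) := fun n ↦
    (measurable_of_finite fun k ↦
      ENNReal.ofReal (klFun (P.real (g n ⁻¹' {k}) / R.real (g n ⁻¹' {k})))).comp (hgm n)
  rw [klDiv_eq_lintegral_klFun_of_ac h]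
  calc ∫⁻ x, ENNReal.ofReal (klFun (P.rnDeriv R x).toReal) ∂ R
      = ∫⁻ x, liminf (fun n ↦ F n x) atTop ∂ R := by
        refine lintegral_congr_ae ?_
        filter_upwards [ae_tendsto_measureReal_div_truncFloor h (fun _ _ ↦ rfl) hgm] with x hx
        exact ((ENNReal.continuous_ofReal.comp continuous_klFun).tendsto _ |>.comp hx).liminf_eq.symm
    _ ≤ liminf (fun n ↦ ∫⁻ x, F n x ∂ R) atTop := lintegral_liminf_le hFm
    _ ≤ t := by
        refine liminf_le_of_frequently_le' (.of_forall fun n ↦ ?_)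
        exact (FinPartition.lintegral_klFun_ofMeasurable (g n) (hgm n) P R).trans_le (ht _)

end Approximation

open Classical in
theorem gyp_kl {X : Type*} [MeasurableSpace X]
    (P R : Measure X) [IsProbabilityMeasure P] [IsProbabilityMeasure R]
    (h : P ≪ R) :
    (if Integrable (llr P R) P then ((∫ x, llr P R x ∂P : ℝ) : EReal) else ⊤)
      = ⨆ π : FinPartition X, ((∑ k, (P (π.E k)).toReal *
          Real.log ((P (π.E k)).toReal / (R (π.E k)).toReal) : ℝ) : EReal) := by
  have hlhs : (if Integrable (llr P R) P then ((∫ x, llr P R x ∂P : ℝ) : EReal) else ⊤)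
      = (klDiv P R : EReal) := by
    split_ifs with hint
    · rw [← toReal_klDiv_of_measure_eq h (by simp),
        EReal.coe_ennreal_toReal (klDiv_ne_top h hint)]
    · simp [klDiv_of_not_integrable hint]
  have hterm : ∀ π : FinPartition X, ((∑ k, (P (π.E k)).toReal *
      Real.log ((P (π.E k)).toReal / (R (π.E k)).toReal) : ℝ) : EReal)
      = (ENNReal.ofReal
        (∑ k, R.real (π.E k) * klFun (P.real (π.E k) / R.real (π.E k))) : ℝ≥0∞) := fun π ↦ by
    rw [π.sum_mul_log_eq_sum_klFun h, EReal.coe_ennreal_ofReal,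
      max_eq_left (π.sum_klFun_nonneg P R)]
  rw [hlhs, iSup_congr hterm]
  refine le_antisymm ?_ (iSup_le fun π ↦ EReal.coe_ennreal_le_coe_ennreal_iff.mpr
    (π.ofReal_sum_klFun_le_klDiv h))
  set S : EReal := ⨆ π : FinPartition X, ((ENNReal.ofReal
    (∑ k, R.real (π.E k) * klFun (P.real (π.E k) / R.real (π.E k))) : ℝ≥0∞) : EReal)
  have hle : ∀ π : FinPartition X, ((ENNReal.ofReal
      (∑ k, R.real (π.E k) * klFun (P.real (π.E k) / R.real (π.E k))) : ℝ≥0∞) : EReal) ≤ S :=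
    fun π ↦ le_iSup (fun π : FinPartition X ↦ ((ENNReal.ofReal
      (∑ k, R.real (π.E k) * klFun (P.real (π.E k) / R.real (π.E k))) : ℝ≥0∞) : EReal)) π
  have hS0 : 0 ≤ S := (EReal.coe_ennreal_nonneg _).trans
    (hle (FinPartition.ofMeasurable (fun _ ↦ (0 : Fin 1)) measurable_const))
  rw [← EReal.coe_toENNReal hS0] at hle ⊢
  exact EReal.coe_ennreal_le_coe_ennreal_iff.mpr (klDiv_le_of_forall_finPartition h
    fun π ↦ EReal.coe_ennreal_le_coe_ennreal_iff.mp (hle π))
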